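/- Let 0 < δ₀ < 1 and E > 0. If δ ∈ (0, δ₀) is small enough, then there exist B, R, R₀ > 0 with B = (δ₀^{-1} + E/4) w(R) and w(R₀) = 4B/E (so that the function ψ(r) defined as δ₀^{-1} for r ≤ R, as B/w(r) - E/4 for R < r < R₀, and as 0 for r ≥ R₀, is continuous and nonnegative), and such that for all r > 0 with r ≠ R and r ≠ R₀: -E/2 ≤ ψ(r) - V(r,ω) - (∂_rV(r,ω) - ψ'(r)) w(r)/w'(r) for almost every ω ∈ S^{n-1}. -/

import Mathlib

open MeasureTheory Real Set Topology Filter Asymptotics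

/-- `w(r) = 1 - (1+r)^{-δ}`. -/
noncomputable def w (δ r : ℝ) : ℝ := 1 - (1 + r) ^ (-δ)

/-- `w'(r) = δ (1+r)^{-1-δ}`. -/
noncomputable def wd (δ r : ℝ) : ℝ := δ * (1 + r) ^ (-1 - δ)

/-- `G_δ(r) = (1+r)^{-δ₀} + δ⁻¹ (1 - (1+r)^{-δ}) (1+r)^{δ-δ₀}`. -/
noncomputable def G (δ₀ δ r : ℝ) : ℝ :=
  (1 + r) ^ (-δ₀) + δ⁻¹ * (1 - (1 + r) ^ (-δ)) * (1 + r) ^ (δ - δ₀)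
/-- The piecewise function `ψ`: `δ₀⁻¹` for `r ≤ R`, `B/w(r) - E/4` for `R < r < R₀`,
and `0` for `r ≥ R₀`. -/
noncomputable def psi (δ₀ E B R R₀ δ : ℝ) (r : ℝ) : ℝ :=
  if r ≤ R then δ₀⁻¹ else if r < R₀ then B / w δ r - E / 4 else 0

/-- The derivative `ψ'` of `ψ` (away from `r = R, R₀`): `0` for `r < R`,
`-B w'(r)/w(r)²` for `R < r < R₀`, and `0` for `r > R₀`. -/
noncomputable def psid (B R R₀ δ : ℝ) (r : ℝ) : ℝ :=
  if r ≤ R then 0 else if r < R₀ then -(B * wd δ r / (w δ r) ^ 2) else 0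

theorem one_sub_rpow_neg_le_mul_log {s : ℝ} (hs : 0 < s) (δ : ℝ) :
    1 - s ^ (-δ) ≤ δ * log s := by
  rw [rpow_def_of_pos hs]
  linarith [add_one_le_exp (log s * -δ)]

theorem w_pos {δ r : ℝ} (hδ : 0 < δ) (hr : 0 < r) : 0 < w δ r := by
  have := rpow_lt_one_of_one_lt_of_neg (x := 1 + r) (z := -δ) (by linarith) (by linarith)
  unfold w
  linarith

theorem wd_pos {δ r : ℝ} (hδ : 0 < δ) (hr : 0 < r) : 0 < wd δ r :=
  mul_pos hδ (rpow_pos_of_pos (by linarith) _)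

theorem w_le_w {δ r t : ℝ} (hδ : 0 < δ) (hr : 0 < r) (hrt : r ≤ t) : w δ r ≤ w δ t := by
  have := rpow_le_rpow_of_nonpos (x := 1 + r) (y := 1 + t) (z := -δ)
    (by linarith) (by linarith) (by linarith)
  unfold w
  linarith

theorem continuousOn_w (δ : ℝ) : ContinuousOn (w δ) (Ioi 0) := by
  refine continuousOn_const.sub (ContinuousOn.rpow_const (by fun_prop) fun x hx => Or.inl ?_)
  have : 0 < x := hx
  linarith

theorem exists_w_eq {δ c : ℝ} (hδ : 0 < δ) (hc : 0 < c) (hc1 : c < 1) :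
    ∃ r, 0 < r ∧ w δ r = c := by
  have h1 : 0 < 1 - c := by linarith
  refine ⟨(1 - c) ^ (-δ⁻¹) - 1, ?_, ?_⟩
  · have := one_lt_rpow_of_pos_of_lt_one_of_neg h1 (by linarith) (neg_lt_zero.2 (inv_pos.2 hδ))
    linarith
  · have : δ⁻¹ * δ = 1 := inv_mul_cancel₀ hδ.ne'
    simp only [w, add_sub_cancel]
    rw [← rpow_mul h1.le, neg_mul_neg, this, rpow_one]
    ring

/-- On `(0, ∞)`, `ψ` is the truncation of `B / w - E / 4` to `[0, δ₀⁻¹]`. -/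
theorem psi_eq_max_min {δ₀ E B R R₀ δ r : ℝ} (hδ₀ : 0 < δ₀) (hδ : 0 < δ) (hE : 0 < E)
    (hB : 0 < B) (hR : 0 < R) (hRR₀ : R < R₀) (hBR : B = (δ₀⁻¹ + E / 4) * w δ R)
    (hwR₀ : w δ R₀ = 4 * B / E) (hr : 0 < r) :
    psi δ₀ E B R R₀ δ r = max 0 (min δ₀⁻¹ (B / w δ r - E / 4)) := by
  have hi : 0 < δ₀⁻¹ := inv_pos.2 hδ₀
  have hw := w_pos hδ hr
  have above : r ≤ R → δ₀⁻¹ ≤ B / w δ r - E / 4 := fun h => by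
    rw [le_sub_iff_add_le, le_div_iff₀ hw, hBR]
    exact mul_le_mul_of_nonneg_left (w_le_w hδ hr h) (by positivity)
  have below : R ≤ r → B / w δ r - E / 4 ≤ δ₀⁻¹ := fun h => by
    rw [sub_le_iff_le_add, div_le_iff₀ hw, hBR]
    exact mul_le_mul_of_nonneg_left (w_le_w hδ hR h) (by positivity)
  have hBE : E / 4 * w δ R₀ = B := by rw [hwR₀]; field_simp
  unfold psi
  split_ifs with h₁ h₂
  · rw [min_eq_left (above h₁), max_eq_right hi.le]
  · rw [min_eq_right (below (le_of_not_ge h₁)), max_eq_right]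
    rw [sub_nonneg, le_div_iff₀ hw, ← hBE]
    exact mul_le_mul_of_nonneg_left (w_le_w hδ hr h₂.le) (by positivity)
  · rw [min_eq_right (below (le_of_not_ge h₁)), max_eq_left]
    rw [sub_nonpos, div_le_iff₀ hw, ← hBE]
    exact mul_le_mul_of_nonneg_left (w_le_w hδ (hR.trans hRR₀) (not_lt.1 h₂)) (by positivity)

theorem add_mul_div_le_G {δ₀ δ r v v' : ℝ} (hδ : 0 < δ) (hr : 0 < r)
    (hv : v ≤ (1 + r) ^ (-δ₀)) (hv' : v' ≤ (1 + r) ^ (-1 - δ₀)) :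
    v + v' * (w δ r / wd δ r) ≤ G δ₀ δ r := by
  have hs : 0 < 1 + r := by linarith
  refine add_le_add hv ?_
  refine (mul_le_mul_of_nonneg_right hv' (div_pos (w_pos hδ hr) (wd_pos hδ hr)).le).trans_eq ?_
  have h : (1 + r) ^ (-1 - δ₀) = (1 + r) ^ (-1 - δ) * (1 + r) ^ (δ - δ₀) := by
    rw [← rpow_add hs]
    ring_nf
  have := (rpow_pos_of_pos hs (-1 - δ)).ne'
  rw [h, w, wd]
  field_simp

theorem G_le_rpow_add_log_mul_rpow {δ₀ δ r : ℝ} (hδ : 0 < δ) (hr : 0 < r) :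
    G δ₀ δ r ≤ (1 + r) ^ (-δ₀) + log (1 + r) * (1 + r) ^ (δ - δ₀) := by
  have hs : 0 < 1 + r := by linarith
  have := rpow_pos_of_pos hs (δ - δ₀)
  unfold G
  gcongr
  rw [inv_mul_le_iff₀ hδ]
  exact one_sub_rpow_neg_le_mul_log hs δ

theorem G_le_rpow_mul_inv {δ₀ δ r : ℝ} (hδ₀ : 0 < δ₀) (hδ₀' : δ₀ ≤ 1) (hδ : 0 < δ)
    (hr : 0 < r) : G δ₀ δ r ≤ (1 + r) ^ δ * δ₀⁻¹ := by
  have hs : 0 < 1 + r := by linarith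
  have hlog : 0 ≤ log (1 + r) := log_nonneg (by linarith)
  have h1 : 1 ≤ (1 + r) ^ δ := one_le_rpow (by linarith) hδ.le
  have h0 : 0 < (1 + r) ^ (-δ₀) := rpow_pos_of_pos hs _
  have hmain : (1 + r) ^ (-δ₀) * (1 + log (1 + r)) ≤ δ₀⁻¹ := by
    rw [rpow_neg hs.le, inv_mul_le_iff₀ (rpow_pos_of_pos hs _), ← div_eq_mul_inv,
      le_div_iff₀ hδ₀, rpow_def_of_pos hs]
    linarith [add_one_le_exp (log (1 + r) * δ₀)]
  calc G δ₀ δ r ≤ (1 + r) ^ (-δ₀) + log (1 + r) * (1 + r) ^ (δ - δ₀) :=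
        G_le_rpow_add_log_mul_rpow hδ hr
    _ = 1 * (1 + r) ^ (-δ₀) + (1 + r) ^ δ * ((1 + r) ^ (-δ₀) * log (1 + r)) := by
        rw [sub_eq_add_neg, rpow_add hs]
        ring
    _ ≤ (1 + r) ^ δ * (1 + r) ^ (-δ₀) + (1 + r) ^ δ * ((1 + r) ^ (-δ₀) * log (1 + r)) := by
        gcongr
    _ = (1 + r) ^ δ * ((1 + r) ^ (-δ₀) * (1 + log (1 + r))) := by ring
    _ ≤ (1 + r) ^ δ * δ₀⁻¹ := by gcongr

/-- `G δ₀ δ` decays at infinity uniformly in `δ ∈ (0, δ₀ / 2]`. -/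
theorem exists_forall_G_le {δ₀ ε : ℝ} (hδ₀ : 0 < δ₀) (hε : 0 < ε) :
    ∃ R, 0 < R ∧ ∀ δ, 0 < δ → δ ≤ δ₀ / 2 → ∀ r, R ≤ r → G δ₀ δ r ≤ ε := by
  have hlim : Tendsto (fun s : ℝ => s ^ (-δ₀) + log s * s ^ (-(δ₀ / 2))) atTop (𝓝 0) := by
    have h := (isLittleO_log_rpow_atTop (half_pos hδ₀)).tendsto_div_nhds_zero
    have h' := (tendsto_rpow_neg_atTop hδ₀).add h
    rw [add_zero] at h'
    refine h'.congr' ?_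
    filter_upwards [eventually_ge_atTop 0] with s hs
    rw [rpow_neg hs (δ₀ / 2), div_eq_mul_inv]
  obtain ⟨S, hS⟩ := eventually_atTop.1 (hlim.eventually_le_const hε)
  refine ⟨max S 1, by positivity, fun δ hδ hδ' r hr => ?_⟩
  have hr1 : 1 ≤ r := (le_max_right _ _).trans hr
  have hSr : S ≤ 1 + r := by linarith [(le_max_left S 1).trans hr]
  refine (G_le_rpow_add_log_mul_rpow hδ (by linarith)).trans (le_trans ?_ (hS _ hSr))
  have : 0 ≤ log (1 + r) := log_nonneg (by linarith)
  gcongr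
  · linarith
  · linarith

/-- For `δ ∈ (0,δ₀)` small enough, there are `B, R, R₀ > 0` with
`B = (δ₀⁻¹ + E/4) w(R)` and `w(R₀) = 4B/E`, making `ψ` continuous and nonnegative,
such that for all `r > 0` with `r ≠ R, R₀` and all `ω`:
`-E/2 ≤ ψ - V - (∂_r V - ψ') w/w'`. -/
theorem psi_construction
    (n : ℕ) (δ₀ E : ℝ) (hδ₀ : 0 < δ₀) (hδ₀' : δ₀ < 1) (hE : 0 < E)
    (V Vr : ℝ → Metric.sphere (0 : EuclideanSpace ℝ (Fin n)) 1 → ℝ)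
    (hVbdd : ∃ M : ℝ, ∀ r ω, |V r ω| ≤ M) (hVrbdd : ∃ M : ℝ, ∀ r ω, |Vr r ω| ≤ M)
    (hVderiv : ∀ ω, ∀ r, 0 < r → HasDerivAt (fun t => V t ω) (Vr r ω) r)
    (hVle : ∀ r, 0 < r → ∀ ω, V r ω ≤ (1 + r) ^ (-δ₀))
    (hVrle : ∀ r, 0 < r → ∀ ω, Vr r ω ≤ (1 + r) ^ (-1 - δ₀)) :
    ∃ δ₁ > (0 : ℝ), ∀ δ, 0 < δ → δ < δ₀ → δ ≤ δ₁ →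
      ∃ B R R₀ : ℝ, 0 < B ∧ 0 < R ∧ R < R₀ ∧
        B = (δ₀⁻¹ + E / 4) * w δ R ∧
        w δ R₀ = 4 * B / E ∧
        ContinuousOn (psi δ₀ E B R R₀ δ) (Set.Ioi 0) ∧
        (∀ r, 0 < r → 0 ≤ psi δ₀ E B R R₀ δ r) ∧
        ∀ r, 0 < r → r ≠ R → r ≠ R₀ → ∀ ω,
          -E / 2 ≤ psi δ₀ E B R R₀ δ r - V r ω -
            (Vr r ω - psid B R R₀ δ r) * (w δ r / wd δ r) := by
  obtain ⟨R, hR, hGR⟩ := exists_forall_G_le hδ₀ (show 0 < E / 4 by positivity)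
  have hi : 0 < δ₀⁻¹ := inv_pos.2 hδ₀
  have hK : 0 < log (1 + R) := log_pos (by linarith)
  have hlog : 0 < log (1 + δ₀ * E / 2) := log_pos (by linarith [mul_pos hδ₀ hE])
  have hC : 0 < (4 / E) * (δ₀⁻¹ + E / 4) := by positivity
  refine ⟨min (δ₀ / 2) (min (log (1 + δ₀ * E / 2) / log (1 + R))
    (1 / (2 * (4 / E * (δ₀⁻¹ + E / 4)) * log (1 + R)))), by positivity, fun δ hδ _ hδ₁ => ?_⟩
  simp only [le_min_iff] at hδ₁
  obtain ⟨hδhalf, hδlog, hδC⟩ := hδ₁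
  rw [le_div_iff₀ hK] at hδlog
  rw [le_div_iff₀ (by positivity)] at hδC
  have hwR := w_pos hδ hR
  set B := (δ₀⁻¹ + E / 4) * w δ R with hB
  have hBpos : 0 < B := by positivity
  have hBE : 4 * B / E = 4 / E * (δ₀⁻¹ + E / 4) * w δ R := by rw [hB]; ring
  have hlt : 4 * B / E < 1 := by
    have := mul_le_mul_of_nonneg_left
      (one_sub_rpow_neg_le_mul_log (show 0 < 1 + R by linarith) δ) hC.le
    rw [hBE, w]
    linarith
  obtain ⟨R₀, hR₀, hwR₀⟩ := exists_w_eq hδ (show 0 < 4 * B / E by positivity) hlt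
  have hRR₀ : R < R₀ := by
    by_contra! h
    have hle := w_le_w hδ hR₀ h
    have hgt : 4 / E * (δ₀⁻¹ + E / 4) * w δ R = 4 / E * δ₀⁻¹ * w δ R + w δ R := by
      field_simp
    have : 0 < 4 / E * δ₀⁻¹ * w δ R := by positivity
    linarith
  have hpsi := fun r (hr : 0 < r) => psi_eq_max_min hδ₀ hδ hE hBpos hR hRR₀ hB hwR₀ hr
  refine ⟨B, R, R₀, hBpos, hR, hRR₀, rfl, hwR₀, ?_, ?_, ?_⟩
  · refine ContinuousOn.congr ?_ hpsi
    exact ContinuousOn.sup continuousOn_const (ContinuousOn.inf continuousOn_const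
      ((continuousOn_const.div (continuousOn_w δ) fun r hr => (w_pos hδ hr).ne').sub
        continuousOn_const))
  · intro r hr
    rw [hpsi r hr]
    exact le_max_left _ _
  · intro r hr _ _ ω
    have hG := add_mul_div_le_G hδ hr (hVle r hr ω) (hVrle r hr ω)
    have hw := (w_pos hδ hr).ne'
    have hwd := (wd_pos hδ hr).ne'
    unfold psi psid
    split_ifs with h₁ h₂
    · have hS : (1 + r) ^ δ ≤ 1 + δ₀ * E / 2 := by
        calc (1 + r) ^ δ ≤ (1 + R) ^ δ := by gcongr
          _ = exp (δ * log (1 + R)) := by rw [rpow_def_of_pos (by linarith), mul_comm]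
          _ ≤ exp (log (1 + δ₀ * E / 2)) := exp_le_exp.2 hδlog
          _ = 1 + δ₀ * E / 2 := exp_log (by positivity)
      have h := (G_le_rpow_mul_inv hδ₀ hδ₀'.le hδ hr).trans
        (mul_le_mul_of_nonneg_right hS hi.le)
      have : (1 + δ₀ * E / 2) * δ₀⁻¹ = δ₀⁻¹ + E / 2 := by field_simp
      linarith
    · have := hGR δ hδ hδhalf r (le_of_not_ge h₁)
      have hcancel : B * wd δ r / w δ r ^ 2 * (w δ r / wd δ r) = B / w δ r := by
        field_simp
      linarith
    · have := hGR δ hδ hδhalf r (le_of_not_ge h₁)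
      linarith
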